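/- (Strict properness of the censoring-adjusted binary cross-entropy for the k-th competing event) Fix a time horizon ζ ∈ ℝ with G(ζ) > 0 and an event index k ∈ Fin K, and assume 0 < F_k(ζ) < 1. For p ∈ (0, 1) define the pointwise censoring-adjusted log-score LL_{k,ζ}(p)(ω) = 1{T(ω) ≤ ζ ∧ Δ(ω) = k ∧ T(ω) < C(ω)} · log(p) / G(T(ω)) + 1{T(ω) ≤ ζ ∧ Δ(ω) ≠ k ∧ T(ω) < C(ω)} · log(1 − p) / G(T(ω)) + 1{T(ω) > ζ ∧ C(ω) > ζ} · log(1 − p) / G(ζ). Then (i) ∫_Ω LL_{k,ζ}(p) dℙ = F_k(ζ) · log(p) + (1 − F_k(ζ)) · log(1 − p), and (ii) for every p ∈ (0, 1), ∫_Ω LL_{k,ζ}(p) dℙ ≤ ∫_Ω LL_{k,ζ}(F_k(ζ)) dℙ, with equality if and only if p = F_k(ζ). -/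

import Mathlib

open MeasureTheory ProbabilityTheory

/-- The pointwise censoring-adjusted binary cross-entropy (log) score for the
`k`-th competing event at horizon `ζ`, evaluated at candidate probability `p`. -/
noncomputable def logScore {Ω : Type*} {K : ℕ}
    (T : Ω → ℝ) (Δ : Ω → Fin K) (C : Ω → ℝ) (G : ℝ → ℝ) (ζ : ℝ) (k : Fin K)
    (p : ℝ) (ω : Ω) : ℝ :=
  Set.indicator {ω' | T ω' ≤ ζ ∧ Δ ω' = k ∧ T ω' < C ω'}
      (fun ω' => Real.log p / G (T ω')) ω
  + Set.indicator {ω' | T ω' ≤ ζ ∧ Δ ω' ≠ k ∧ T ω' < C ω'}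
      (fun ω' => Real.log (1 - p) / G (T ω')) ω
  + Set.indicator {ω' | ζ < T ω' ∧ ζ < C ω'} (fun _ => Real.log (1 - p) / G ζ) ω

theorem ipcw_aux {Ω E : Type*} [MeasurableSpace Ω] [MeasurableSpace E]
    (P : Measure Ω) [IsProbabilityMeasure P]
    (X : Ω → E) (C : Ω → ℝ) (hX : Measurable X) (hC : Measurable C)
    (hindep : IndepFun X C P)
    (G : ℝ → ℝ) (hG : ∀ t, G t = (P {ω | t < C ω}).toReal)
    (ζ : ℝ) (hGζ : 0 < G ζ) (g : E → ℝ) (hg : Measurable g) (hgζ : ∀ x, g x ≤ ζ)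
    (A : Set E) (hA : MeasurableSet A) (c : ℝ) :
    Integrable (Set.indicator {ω | X ω ∈ A ∧ g (X ω) < C ω} (fun ω => c / G (g (X ω)))) P ∧
    ∫ ω, Set.indicator {ω | X ω ∈ A ∧ g (X ω) < C ω} (fun ω => c / G (g (X ω))) ω ∂P
      = P.real (X ⁻¹' A) * c := by
  have hanti : Antitone G := by
    intro a b hab
    rw [hG, hG]
    refine ENNReal.toReal_mono (measure_ne_top _ _) (measure_mono ?_)
    intro ω hω
    exact lt_of_le_of_lt hab hω
  have hGm : Measurable G := hanti.measurable
  have hpos : ∀ x, G ζ ≤ G (g x) := fun x => hanti (hgζ x)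
  set B : Set (E × ℝ) := {z | z.1 ∈ A ∧ g z.1 < z.2} with hB
  have hBm : MeasurableSet B :=
    (measurable_fst hA).inter (measurableSet_lt (hg.comp measurable_fst) measurable_snd)
  set f : E × ℝ → ℝ := B.indicator (fun z => c / G (g z.1)) with hf
  have hfm : Measurable f :=
    (measurable_const.div (hGm.comp (hg.comp measurable_fst))).indicator hBm
  have hbd : ∀ z, ‖f z‖ ≤ |c| / G ζ := by
    intro z
    refine (norm_indicator_le_norm_self _ _).trans ?_
    rw [Real.norm_eq_abs, abs_div, abs_of_pos (hGζ.trans_le (hpos _))]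
    exact div_le_div_of_nonneg_left (abs_nonneg c) hGζ (hpos _)
  have hXC : Measurable (fun ω => (X ω, C ω)) := hX.prodMk hC
  have heq : Set.indicator {ω | X ω ∈ A ∧ g (X ω) < C ω} (fun ω => c / G (g (X ω)))
      = fun ω => f (X ω, C ω) := by
    ext ω
    simp [hf, hB, Set.indicator]
  rw [heq]
  have : IsProbabilityMeasure (P.map X) := Measure.isProbabilityMeasure_map hX.aemeasurable
  have : IsProbabilityMeasure (P.map C) := Measure.isProbabilityMeasure_map hC.aemeasurable
  refine ⟨Integrable.of_bound (hfm.comp hXC).aestronglyMeasurable _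
    (Filter.Eventually.of_forall fun ω => hbd _), ?_⟩
  have h1 : ∫ ω, f (X ω, C ω) ∂P = ∫ z, f z ∂(P.map (fun ω => (X ω, C ω))) :=
    (integral_map hXC.aemeasurable hfm.aestronglyMeasurable).symm
  rw [h1, (indepFun_iff_map_prod_eq_prod_map_map hX.aemeasurable hC.aemeasurable).1 hindep,
    integral_prod _ (Integrable.of_bound hfm.aestronglyMeasurable _
      (Filter.Eventually.of_forall hbd))]
  have h2 : ∀ x, ∫ y, f (x, y) ∂(P.map C) = A.indicator (fun _ => c) x := by
    intro x
    by_cases hx : x ∈ A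
    · have : (fun y => f (x, y)) = (Set.Ioi (g x)).indicator (fun _ => c / G (g x)) := by
        ext y
        simp [hf, hB, Set.indicator, hx]
      rw [this, integral_indicator_const _ measurableSet_Ioi, Set.indicator_of_mem hx,
        map_measureReal_apply hC measurableSet_Ioi]
      have h3 : P.real (C ⁻¹' Set.Ioi (g x)) = G (g x) := by rw [hG]; rfl
      have h4 := (hGζ.trans_le (hpos x)).ne'
      rw [h3, smul_eq_mul]
      field_simp
    · simp [hf, hB, Set.indicator, hx]
  simp_rw [h2]
  rw [integral_indicator_const _ hA, map_measureReal_apply hX hA, smul_eq_mul]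

theorem gibbs_aux (a p : ℝ) (ha : a ∈ Set.Ioo (0:ℝ) 1) (hp : p ∈ Set.Ioo (0:ℝ) 1)
    (hne : p ≠ a) :
    a * Real.log p + (1 - a) * Real.log (1 - p)
      < a * Real.log a + (1 - a) * Real.log (1 - a) := by
  obtain ⟨ha0, ha1⟩ := ha
  obtain ⟨hp0, hp1⟩ := hp
  have h1 : Real.log (p / a) < p / a - 1 :=
    Real.log_lt_sub_one_of_pos (by positivity) (by
      intro h
      exact hne ((div_eq_one_iff_eq ha0.ne').1 h))
  have h2 : Real.log ((1 - p) / (1 - a)) ≤ (1 - p) / (1 - a) - 1 :=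
    Real.log_le_sub_one_of_pos (div_pos (by linarith) (by linarith))
  rw [Real.log_div hp0.ne' ha0.ne'] at h1
  rw [Real.log_div (by linarith) (by linarith)] at h2
  have h3 := mul_lt_mul_of_pos_left h1 ha0
  have h4 := mul_le_mul_of_nonneg_left h2 (by linarith : 0 ≤ 1 - a)
  have h5 : a * (p / a - 1) = p - a := by field_simp
  have h6 : (1 - a) * ((1 - p) / (1 - a) - 1) = a - p := by
    have : 1 - a ≠ 0 := by linarith
    field_simp
    ring
  rw [h5] at h3
  rw [h6] at h4
  linarith

/-- (Strict properness of the censoring-adjusted binary cross-entropy for the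
k-th competing event) For `0 < F k ζ < 1` and any candidate `p ∈ (0, 1)`:
(i) the expected censoring-adjusted log-score equals
`F k ζ * log p + (1 - F k ζ) * log (1 - p)`, and (ii) it is at most the expected
score of the oracle `F k ζ`, with equality iff `p = F k ζ`. -/
theorem logScore_strictly_proper
    {Ω : Type*} [MeasurableSpace Ω] (P : Measure Ω) [IsProbabilityMeasure P]
    {K : ℕ} (hK : 1 ≤ K)
    (T : Ω → ℝ) (Δ : Ω → Fin K) (C : Ω → ℝ)
    (hT : Measurable T) (hΔ : Measurable Δ) (hC : Measurable C)
    (hindep : IndepFun (fun ω => (T ω, Δ ω)) C P)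
    (G : ℝ → ℝ) (hG : ∀ t, G t = (P {ω | t < C ω}).toReal)
    (F : Fin K → ℝ → ℝ)
    (hF : ∀ k t, F k t = (P {ω | T ω ≤ t ∧ Δ ω = k}).toReal)
    (ζ : ℝ) (hGζ : 0 < G ζ) (k : Fin K)
    (hFk : F k ζ ∈ Set.Ioo (0:ℝ) 1)
    (p : ℝ) (hp : p ∈ Set.Ioo (0:ℝ) 1) :
    (∫ ω, logScore T Δ C G ζ k p ω ∂P
        = F k ζ * Real.log p + (1 - F k ζ) * Real.log (1 - p))
    ∧ (∫ ω, logScore T Δ C G ζ k p ω ∂P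
        ≤ ∫ ω, logScore T Δ C G ζ k (F k ζ) ω ∂P)
    ∧ ((∫ ω, logScore T Δ C G ζ k p ω ∂P
          = ∫ ω, logScore T Δ C G ζ k (F k ζ) ω ∂P)
        ↔ p = F k ζ) := by
  have key : ∀ q : ℝ, ∫ ω, logScore T Δ C G ζ k q ω ∂P
        = F k ζ * Real.log q + (1 - F k ζ) * Real.log (1 - q) := by
    intro q
    have hX : Measurable (fun ω => (T ω, Δ ω)) := hT.prodMk hΔ
    have aux := ipcw_aux P (fun ω => (T ω, Δ ω)) C hX hC hindep G hG ζ hGζ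
      (fun x => min x.1 ζ) (measurable_fst.min measurable_const) (fun x => min_le_right _ _)
    have hA1 : MeasurableSet {x : ℝ × Fin K | x.1 ≤ ζ ∧ x.2 = k} :=
      (measurableSet_le measurable_fst measurable_const).inter
        (measurable_snd (measurableSet_singleton k))
    have e : ∀ ω, logScore T Δ C G ζ k q ω =
        Set.indicator {ω | (T ω, Δ ω) ∈ {x : ℝ × Fin K | x.1 ≤ ζ ∧ x.2 = k} ∧ min (T ω) ζ < C ω}
          (fun ω => Real.log q / G (min (T ω) ζ)) ω
        + Set.indicator {ω | (T ω, Δ ω) ∈ {x : ℝ × Fin K | x.1 ≤ ζ ∧ x.2 = k}ᶜ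
            ∧ min (T ω) ζ < C ω}
          (fun ω => Real.log (1 - q) / G (min (T ω) ζ)) ω := by
      intro ω
      unfold logScore
      rcases le_or_gt (T ω) ζ with h | h
      · have ho : (T ω < C ω ∨ ζ < C ω) ↔ T ω < C ω :=
          or_iff_left_of_imp fun h' => h.trans_lt h'
        by_cases hk : Δ ω = k <;> simp [Set.indicator, h, hk, not_lt.2 h, ho]
      · have ho : (T ω < C ω ∨ ζ < C ω) ↔ ζ < C ω :=
          or_iff_right_of_imp fun h' => h.trans h'
        simp [Set.indicator, h, not_le.2 h, h.le, ho]
    obtain ⟨i1, v1⟩ := aux _ hA1 (Real.log q)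
    obtain ⟨i2, v2⟩ := aux _ hA1.compl (Real.log (1 - q))
    simp_rw [e]
    have hFe : P.real ((fun ω => (T ω, Δ ω)) ⁻¹' {x : ℝ × Fin K | x.1 ≤ ζ ∧ x.2 = k})
        = F k ζ := by rw [hF]; rfl
    rw [integral_add i1 i2, v1, v2, Set.preimage_compl, probReal_compl_eq_one_sub (hX hA1), hFe]
  rw [key, key]
  refine ⟨rfl, ?_, ?_, ?_⟩
  · by_cases h : p = F k ζ
    · rw [h]
    · exact (gibbs_aux _ _ hFk hp h).le
  · intro h
    by_contra hne
    exact (gibbs_aux _ _ hFk hp hne).ne h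
  · intro h
    rw [← h]
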